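/- For every discount factor λ ∈ [0,1), every initial state s₀ ∈ S, every player i ∈ I, every partition 𝒟^i of the set of states, and every cutoff vector c^i ∈ ℝ^{𝒟^i}: underline-v̂^i_{λ,stat}(s₀;𝒟^i,c^i) = max_{x^i stationary} min_{σ^{-i}∈Σ^{-i}} γ̂^i_λ(s₀,x^i,σ^{-i};𝒟^i,c^i); that is, restricting the minimizing players to stationary strategies does not change the max-min value in stationary strategies of the modified game. -/

import Mathlib

open MeasureTheory Filter Topology
open scoped ENNReal

noncomputable section

/-- A finite stochastic game: a finite set of players `I`, a finite set of states `S`,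
finite nonempty action sets `A i s`, stage payoffs `u` bounded by `1` in absolute value,
and transition probabilities `q`. -/
structure StocGame where
  (I : Type)
  (S : Type)
  (A : I → S → Type)
  [fintypeI : Fintype I]
  [fintypeS : Fintype S]
  [decI : DecidableEq I]
  [decS : DecidableEq S]
  [fintypeA : ∀ i s, Fintype (A i s)]
  [decA : ∀ i s, DecidableEq (A i s)]
  [nonemptyA : ∀ i s, Nonempty (A i s)]
  (u : I → (s : S) → ((j : I) → A j s) → ℝ)
  (u_bdd : ∀ i s a, |u i s a| ≤ 1)
  (q : (s : S) → ((j : I) → A j s) → S → ℝ)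
  (q_nonneg : ∀ s a s', 0 ≤ q s a s')
  (q_sum : ∀ s a, ∑ s', q s a s' = 1)

namespace StocGame

attribute [instance] fintypeI fintypeS decI decS fintypeA decA nonemptyA

/-- A mixed action over a finite set of actions. -/
abbrev Mixed (α : Type) [Fintype α] : Type := {f : α → ℝ // (∀ a, 0 ≤ f a) ∧ ∑ a, f a = 1}

variable {G : StocGame}

/-- Action profiles available at state `s`. -/
abbrev Prof (G : StocGame) (s : G.S) : Type := (j : G.I) → G.A j s

/-- A pair of a state together with an action profile at that state. -/
abbrev Step (G : StocGame) : Type := Σ s : G.S, G.Prof s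

/-- A finite history: a (reversed) list of past (state, action profile) steps,
together with the current state. -/
abbrev Hist (G : StocGame) : Type := List G.Step × G.S

/-- A behavior strategy of player `i`. -/
abbrev BStrat (G : StocGame) (i : G.I) : Type := (h : G.Hist) → Mixed (G.A i h.2)

/-- A (behavior) strategy profile. -/
abbrev Profile (G : StocGame) : Type := (i : G.I) → G.BStrat i

/-- A stationary strategy of player `i`. -/
abbrev Stat (G : StocGame) (i : G.I) : Type := (s : G.S) → Mixed (G.A i s)

/-- A stationary strategy profile. -/
abbrev StatProf (G : StocGame) : Type := (i : G.I) → G.Stat i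

/-- The behavior strategy profile induced by a stationary strategy profile. -/
def toB (x : G.StatProf) : G.Profile := fun i h => x i h.2

/-- The behavior strategy induced by a stationary strategy. -/
def toB1 {i : G.I} (x : G.Stat i) : G.BStrat i := fun h => x h.2

/-- A stationary strategy profile is pure if at every state each player
puts probability `1` on a single action. -/
def IsPureStat (x : G.StatProf) : Prop :=
  ∀ (i : G.I) (s : G.S), ∃ a : G.A i s, ∀ b, (x i s).1 b = if b = a then 1 else 0

/-- The probability, under strategy profile `σ` and initial state `s0`, that the play follows
the finite history whose (reversed) list of steps is the first argument and whose current
state is the second argument. -/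
def probHistAux (s0 : G.S) (σ : G.Profile) : List G.Step → G.S → ℝ
  | [], s => if s = s0 then 1 else 0
  | ⟨s', a⟩ :: rest, s =>
      probHistAux s0 σ rest s' * (∏ i, (σ i (rest, s')).1 (a i)) * G.q s' a s

/-- The probability that the play follows the finite history `h`. -/
def probHist (s0 : G.S) (σ : G.Profile) (h : G.Hist) : ℝ := probHistAux s0 σ h.1 h.2

/-- The expected `lam`-discounted time `t_lam(s0,σ;s,a)` that the play spends at the
state-action pair `st = (s,a)`. -/
def tStep (lam : ℝ) (s0 : G.S) (σ : G.Profile) (st : G.Step) : ℝ :=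
  (1 - lam) *
    ∑' h : G.Hist, (if h.1.head? = some st then lam ^ (h.1.length - 1) * probHist s0 σ h else 0)

/-- The expected `lam`-discounted time that the play spends in the set of states `D`. -/
def tSet (lam : ℝ) (s0 : G.S) (σ : G.Profile) (D : Finset G.S) : ℝ :=
  ∑ st : G.Step, if st.1 ∈ D then tStep lam s0 σ st else 0

/-- The `lam`-discounted (unnormalized) payoff `U^i_lam(s0,σ;D)` that player `i` receives
while the play is in `D`. -/
def UD (lam : ℝ) (s0 : G.S) (σ : G.Profile) (i : G.I) (D : Finset G.S) : ℝ :=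
  ∑ st : G.Step, if st.1 ∈ D then tStep lam s0 σ st * G.u i st.1 st.2 else 0

/-- The `lam`-discounted payoff of player `i`. -/
def payoffD (lam : ℝ) (s0 : G.S) (σ : G.Profile) (i : G.I) : ℝ :=
  ∑ st : G.Step, tStep lam s0 σ st * G.u i st.1 st.2

/-- `Di` is a partition of the set of states. -/
def IsPartitionF (Di : Finset (Finset G.S)) : Prop :=
  ∀ s : G.S, ∃! D : Finset G.S, D ∈ Di ∧ s ∈ D

/-- The payoff of player `i` in the modified game, given the partition `Di` and
the cutoffs `c`. -/
def modPayoff (lam : ℝ) (s0 : G.S) (σ : G.Profile) (i : G.I)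
    (Di : Finset (Finset G.S)) (c : Finset G.S → ℝ) : ℝ :=
  ∑ D ∈ Di, min (UD lam s0 σ i D) (tSet lam s0 σ D * c D)

/-- The `lam`-discounted min-max value of player `i` in the original game. -/
def minmaxOrig (G : StocGame) (lam : ℝ) (s0 : G.S) (i : G.I) : ℝ :=
  ⨅ σ : G.Profile, ⨆ σi : G.BStrat i, payoffD lam s0 (Function.update σ i σi) i

/-- The `lam`-discounted max-min value of player `i` in the original game. -/
def maxminOrig (G : StocGame) (lam : ℝ) (s0 : G.S) (i : G.I) : ℝ :=
  ⨆ σi : G.BStrat i, ⨅ σ : G.Profile, payoffD lam s0 (Function.update σ i σi) i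

/-- The min-max value of player `i` in the modified game. -/
def minmaxMod (G : StocGame) (lam : ℝ) (s0 : G.S) (i : G.I)
    (Di : Finset (Finset G.S)) (c : Finset G.S → ℝ) : ℝ :=
  ⨅ σ : G.Profile, ⨆ σi : G.BStrat i,
    modPayoff lam s0 (Function.update σ i σi) i Di c

/-- The max-min value of player `i` in the modified game. -/
def maxminMod (G : StocGame) (lam : ℝ) (s0 : G.S) (i : G.I)
    (Di : Finset (Finset G.S)) (c : Finset G.S → ℝ) : ℝ :=
  ⨆ σi : G.BStrat i, ⨅ σ : G.Profile,
    modPayoff lam s0 (Function.update σ i σi) i Di c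

/-- The min-max value in stationary strategies of player `i` in the modified game. -/
def minmaxModStat (G : StocGame) (lam : ℝ) (s0 : G.S) (i : G.I)
    (Di : Finset (Finset G.S)) (c : Finset G.S → ℝ) : ℝ :=
  ⨅ x : G.StatProf, ⨆ xi : G.Stat i,
    modPayoff lam s0 (Function.update (toB x) i (toB1 xi)) i Di c

/-- The max-min value in stationary strategies of player `i` in the modified game. -/
def maxminModStat (G : StocGame) (lam : ℝ) (s0 : G.S) (i : G.I)
    (Di : Finset (Finset G.S)) (c : Finset G.S → ℝ) : ℝ :=
  ⨆ xi : G.Stat i, ⨅ x : G.StatProf,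
    modPayoff lam s0 (Function.update (toB x) i (toB1 xi)) i Di c

/-! ### Plays and the induced measure -/

/-- A play: the infinite sequence of (state, action profile) pairs. -/
abbrev Play (G : StocGame) : Type := ℕ → G.Step

instance : MeasurableSpace G.Step := ⊤

/-- The finite history consisting of the first `n` stages of the play `p`
(reversed list of the first `n` steps, together with the state at stage `n`). -/
def histOf (p : G.Play) : ℕ → G.Hist
  | 0 => ([], (p 0).1)
  | n + 1 => ((p n) :: (histOf p n).1, (p (n + 1)).1)

/-- The cylinder set of plays whose initial segment is the finite history `h`. -/
def cylSet (h : G.Hist) : Set G.Play := {p | histOf p h.1.length = h}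

/-- `μfam` is the family of probability measures on plays induced (via the
Ionescu–Tulcea theorem) by the initial state and the strategy profile:
it is characterized by being a probability measure giving each cylinder set
the probability of the corresponding finite history. -/
def IsInduced (μfam : G.S → G.Profile → Measure G.Play) : Prop :=
  (∀ s0 σ, IsProbabilityMeasure (μfam s0 σ)) ∧
  ∀ (s0 : G.S) (σ : G.Profile) (h : G.Hist),
    μfam s0 σ (cylSet h) = ENNReal.ofReal (probHist s0 σ h)

/-- A bounded stopping time (with respect to the filtration generated by finite histories). -/
def IsBddST (τ : G.Play → ℕ) : Prop :=
  (∃ B, ∀ p, τ p ≤ B) ∧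
  ∀ p p' n, τ p = n → histOf p n = histOf p' n → τ p' = n

/-- Two states lie in the same element of the partition `Di`. -/
def sameOf (Di : Finset (Finset G.S)) (s s' : G.S) : Prop := ∃ D ∈ Di, s ∈ D ∧ s' ∈ D

open Classical in
/-- The number of switches between elements of a partition along a play,
where the partition is described through the relation `r` ("being in the same element"). -/
def Zsw (r : G.S → G.S → Prop) (p : G.Play) : ℝ≥0∞ :=
  ∑' n : ℕ, if r (p n).1 (p (n + 1)).1 then 0 else 1

/-- The stopping times `τ^𝒟_k` indicating when the play moves from one element of
the partition (described by the relation `r`) to another. -/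
def switchT (r : G.S → G.S → Prop) (p : G.Play) : ℕ → ℕ∞
  | 0 => 0
  | k + 1 => sInf {n : ℕ∞ | ∃ m : ℕ, n = (m : ℕ∞) ∧ switchT r p k < (m : ℕ∞) ∧
      ¬ r (p (m - 1)).1 (p m).1}

/-- The expected average payoff of player `i` in the `N`-stage game. -/
def payoffN (μfam : G.S → G.Profile → Measure G.Play) (N : ℕ) (s0 : G.S)
    (σ : G.Profile) (i : G.I) : ℝ :=
  (∫ p, (∑ n ∈ Finset.range N, G.u i (p n).1 (p n).2) ∂(μfam s0 σ)) / N

/-- `σi` is a uniform `ε`-max-min strategy of player `i` (with respect to the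
uniform max-min value function `v`). -/
def UnifMaxMin (μfam : G.S → G.Profile → Measure G.Play) (v : G.S → ℝ) (i : G.I)
    (σi : G.BStrat i) (ε : ℝ) : Prop :=
  ∃ lam0 : ℝ, 0 ≤ lam0 ∧ lam0 < 1 ∧ ∃ N0 : ℕ,
    ∀ (s0 : G.S) (σ : G.Profile),
      (∀ lam : ℝ, lam0 < lam → lam < 1 →
        v s0 - ε ≤ payoffD lam s0 (Function.update σ i σi) i) ∧
      (∀ τ : G.Play → ℕ, IsBddST τ →
        (N0 : ℝ) ≤ ∫ p, (τ p : ℝ) ∂(μfam s0 (Function.update σ i σi)) →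
        (v s0 - ε) * ∫ p, (τ p : ℝ) ∂(μfam s0 (Function.update σ i σi)) ≤
          ∫ p, (∑ n ∈ Finset.range (τ p), G.u i (p n).1 (p n).2)
            ∂(μfam s0 (Function.update σ i σi)))

/-- `σi` is `(𝒟,ε)`-max-min preserving, where the partition `𝒟` is described by the
relation `r`, and the conditional-expectation requirement is expressed through
integrals over the atoms (cylinder sets) of the σ-algebra of the stopping time `τ^𝒟_k`. -/
def PreservingPart (μfam : G.S → G.Profile → Measure G.Play) (v : G.S → ℝ)
    (r : G.S → G.S → Prop) (i : G.I) (σi : G.BStrat i) (ε : ℝ) : Prop :=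
  ∀ (s0 : G.S) (σ : G.Profile) (k : ℕ) (τ' : G.Play → ℕ), IsBddST τ' →
    (∀ p, switchT r p k ≠ ⊤ →
      switchT r p k < (τ' p : ℕ∞) ∧ (τ' p : ℕ∞) ≤ switchT r p (k + 1)) →
    ∀ h : G.Hist, (∀ p ∈ cylSet h, switchT r p k = (h.1.length : ℕ∞)) →
      ∫ p in cylSet h, (v h.2 - ε) ∂(μfam s0 (Function.update σ i σi)) ≤
        ∫ p in cylSet h, v ((p (τ' p)).1) ∂(μfam s0 (Function.update σ i σi))

/-- `σi` is `ε`-max-min preserving (with respect to arbitrary bounded stopping times);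
again the conditional-expectation requirement is expressed through integrals over the
atoms of the σ-algebra of the stopping time `τ`. -/
def PreservingST (μfam : G.S → G.Profile → Measure G.Play) (v : G.S → ℝ) (i : G.I)
    (σi : G.BStrat i) (ε : ℝ) : Prop :=
  ∀ (s0 : G.S) (σ : G.Profile) (τ τ' : G.Play → ℕ), IsBddST τ → IsBddST τ' →
    (∀ p, τ p < τ' p) →
    ∀ h : G.Hist, (∀ p ∈ cylSet h, τ p = h.1.length) →
      ∫ p in cylSet h, (v h.2 - ε) ∂(μfam s0 (Function.update σ i σi)) ≤
        ∫ p in cylSet h, v ((p (τ' p)).1) ∂(μfam s0 (Function.update σ i σi))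

/-- A history enters a new element of the partition (described by `r`) at its final stage. -/
def entersNew (r : G.S → G.S → Prop) (h : G.Hist) : Prop :=
  match h.1 with
  | [] => True
  | st :: _ => ¬ r st.1 h.2

/-- `σi` is `𝒟`-Markovian: its continuation strategy coincides after any two finite histories
that end at the same state and whose final stage enters a new element of the partition
(described by `r`). -/
def Markovian (r : G.S → G.S → Prop) {i : G.I} (σi : G.BStrat i) : Prop :=
  ∀ h h' : G.Hist, h.2 = h'.2 → entersNew r h → entersNew r h' →
    ∀ (l : List G.Step) (s'' : G.S), σi (l ++ h.1, s'') = σi (l ++ h'.1, s'')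

open Classical in
/-- The portion of the history since the last time the play entered a new element of the
partition (described by `r`): (reversed) list of steps, given the current state. -/
def philist (r : G.S → G.S → Prop) : List G.Step → G.S → List G.Step
  | [], _ => []
  | st :: rest, s => if r st.1 s then st :: philist r rest st.1 else []

/-- The restart strategy `σ^i_𝒟`: whenever the play enters a new element of the partition
(described by `r`), player `i` forgets past play and restarts playing `σi`. -/
def restart {i : G.I} (σi : G.BStrat i) (r : G.S → G.S → Prop) : G.BStrat i :=
  fun h => σi (philist r h.1 h.2, h.2)

/-- The partition `Di` satisfies Property P with respect to player `i`
(whose uniform max-min value function is `v`). -/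
def PropertyP (μfam : G.S → G.Profile → Measure G.Play) (v : G.S → ℝ) (i : G.I)
    (Di : Finset (Finset G.S)) : Prop :=
  ∃ ζ : ℝ, 0 < ζ ∧ ∀ ε : ℝ, 0 < ε → ∃ σi : G.BStrat i,
    Markovian (sameOf Di) σi ∧ UnifMaxMin μfam v i σi ε ∧
    ∀ (s0 : G.S) (σ : G.Profile), ∃ E : Set G.Play,
      ENNReal.ofReal (1 - ε) < μfam s0 (Function.update σ i σi) E ∧
      ∫⁻ p in E, Zsw (sameOf Di) p ∂(μfam s0 (Function.update σ i σi)) ≤ ENNReal.ofReal ζ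

/-- The strategy profile `σ` (whose `i`-th coordinate is the strategy of player `i`) makes
player `i`'s strategy a uniform `𝒟`-subgame-perfect `ε`-min-max strategy against the others'
strategies, at the initial state `s0`; `vbar` is the uniform min-max value function of
player `i`, and the partition `𝒟` is described by the relation `r`.  Conditional-expectation
requirements are expressed through integrals over the atoms (cylinder sets) of the σ-algebra
of the stopping time `τ^𝒟_k`. -/
def SubgamePerfect (μfam : G.S → G.Profile → Measure G.Play) (vbar : G.S → ℝ)
    (r : G.S → G.S → Prop) (i : G.I) (σ : G.Profile) (s0 : G.S) (ε : ℝ) : Prop :=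
  ∃ N0 : ℕ, 0 < N0 ∧
    (∀ N : ℕ, N0 ≤ N → vbar s0 - ε ≤ payoffN μfam N s0 σ i) ∧
    (∀ (k : ℕ) (τ : G.Play → ℕ), IsBddST τ → (∀ p, switchT r p k ≤ (τ p : ℕ∞)) →
      ∀ h : G.Hist, (∀ p ∈ cylSet h, switchT r p k = (h.1.length : ℕ∞)) →
        (∫ p in cylSet h, (vbar h.2 - ε) ∂(μfam s0 σ) ≤
          ∫ p in cylSet h, vbar ((p (τ p)).1) ∂(μfam s0 σ)) ∧
        ((N0 : ℝ) * (μfam s0 σ (cylSet h)).toReal ≤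
            ∫ p in cylSet h, ((τ p : ℝ) - (h.1.length : ℝ)) ∂(μfam s0 σ) →
          (vbar h.2 - ε) * ∫ p in cylSet h, ((τ p : ℝ) - (h.1.length : ℝ)) ∂(μfam s0 σ) ≤
            ∫ p in cylSet h, (∑ n ∈ Finset.Ico h.1.length (τ p), G.u i (p n).1 (p n).2)
              ∂(μfam s0 σ)))

/-- The partition `Di` satisfies Property P' with respect to player `i`
(whose uniform min-max value function is `vbar`). -/
def PropertyP' (μfam : G.S → G.Profile → Measure G.Play) (vbar : G.S → ℝ) (i : G.I)
    (Di : Finset (Finset G.S)) : Prop :=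
  ∃ ζ : ℝ, 0 < ζ ∧ ∀ ε : ℝ, 0 < ε → ∀ (s0 : G.S) (σ : G.Profile), ∃ σi : G.BStrat i,
    SubgamePerfect μfam vbar (sameOf Di) i (Function.update σ i σi) s0 ε ∧
    ∃ E : Set G.Play,
      ENNReal.ofReal (1 - ε) ≤ μfam s0 (Function.update σ i σi) E ∧
      ∫⁻ p in E, Zsw (sameOf Di) p ∂(μfam s0 (Function.update σ i σi)) ≤ ENNReal.ofReal ζ

/-! ### Reachability, closed and strongly controllable sets -/

/-- The first arrival time to the set of states `C`. -/
def hitT (C : Set G.S) (p : G.Play) : ℕ∞ :=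
  sInf {n : ℕ∞ | ∃ m : ℕ, n = (m : ℕ∞) ∧ (p m).1 ∈ C}

/-- State `s` leads in `D` to state `s'`. -/
def LeadsIn (μfam : G.S → G.Profile → Measure G.Play) (D : Set G.S) (s s' : G.S) : Prop :=
  ∃ σ : G.Profile, μfam s σ {p | hitT {s'} p < hitT Dᶜ p} = 1

/-- The states `s` and `s'` are `D`-siblings. -/
def Siblings (μfam : G.S → G.Profile → Measure G.Play) (D : Set G.S) (s s' : G.S) : Prop :=
  LeadsIn μfam D s s' ∧ LeadsIn μfam D s' s

/-- The probability `q(D | s, a)` that the next state lies in `D`. -/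
def qOf (D : Set G.S) (s : G.S) (a : G.Prof s) : ℝ := ∑ s', D.indicator (G.q s a) s'

/-- The set of states `D` is closed. -/
def ClosedSet (G : StocGame) (D : Set G.S) : Prop :=
  ∀ s ∈ D, ∀ a : G.Prof s, qOf D s a = 1

/-- The set of states `D` is strongly controllable. -/
def StronglyContr (G : StocGame) (D : Set G.S) : Prop :=
  ∃ iD : G.I, ∃ sD ∈ D, ∃ atil : G.A iD sD,
    ∀ s ∈ D, ∀ a : G.Prof s, qOf D s a < 1 → s = sD ∧ HEq (a iD) atil

/-- The element of the partition `𝒟` (by the vector of uniform min-max values `v`)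
that contains the state `s`. -/
def Dv (v : G.I → G.S → ℝ) (s : G.S) : Set G.S := {s' | ∀ i, v i s' = v i s}

/-- The element of the refined partition `𝒟*` (refining `𝒟` by the `D`-siblings relation)
that contains the state `s`. -/
def DstarCl (μfam : G.S → G.Profile → Measure G.Play) (v : G.I → G.S → ℝ) (s : G.S) :
    Set G.S := {s' | s' ∈ Dv v s ∧ Siblings μfam (Dv v s) s s'}

/-- The stochastic game is strongly controllable: every element of `𝒟*` is either closed
or strongly controllable. -/
def StronglyControllableGame (G : StocGame) (μfam : G.S → G.Profile → Measure G.Play)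
    (v : G.I → G.S → ℝ) : Prop :=
  ∀ s : G.S, ClosedSet G (DstarCl μfam v s) ∨ StronglyContr G (DstarCl μfam v s)

end StocGame

/-- A set `X ⊆ ℝ^ι` is monovex if every two points of `X` are connected by a continuous
path inside `X` all of whose coordinates are monotone. -/
def Monovex {ι : Type} (X : Set (ι → ℝ)) : Prop :=
  ∀ x ∈ X, ∀ y ∈ X, ∃ f : ℝ → ι → ℝ,
    ContinuousOn f (Set.Icc 0 1) ∧ (∀ t ∈ Set.Icc (0 : ℝ) 1, f t ∈ X) ∧
    f 0 = x ∧ f 1 = y ∧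
    ∀ j : ι, MonotoneOn (fun t => f t j) (Set.Icc 0 1) ∨
      AntitoneOn (fun t => f t j) (Set.Icc 0 1)

end

theorem tsum_list_eq_nil_add_cons {α : Type} [Fintype α] {f : List α → ℝ} (hf : Summable f) :
    ∑' l, f l = f [] + ∑' l, ∑ a, f (a :: l) := by
  let e : Unit ⊕ (List α × α) ≃ List α :=
    { toFun := fun x => match x with
        | Sum.inl _ => []
        | Sum.inr p => p.2 :: p.1
      invFun := fun l => match l with
        | [] => Sum.inl ()
        | a :: l => Sum.inr (l, a)
      left_inv := by rintro (_ | _) <;> rfl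
      right_inv := by rintro (_ | _) <;> rfl }
  have he : Summable (f ∘ e) := e.summable_iff.2 hf
  have hr : Summable (fun p : List α × α => f (p.2 :: p.1)) :=
    he.comp_injective (i := Sum.inr) Sum.inr_injective
  rw [← e.tsum_eq f, Summable.tsum_sum (f := fun x => f (e x))
    (he.comp_injective (i := Sum.inl) Sum.inl_injective) hr, tsum_fintype]
  congr 1
  · simp [e]
  · rw [show (∑' b, f (e (Sum.inr b))) = ∑' p : List α × α, f (p.2 :: p.1) from rfl,
      hr.tsum_prod]
    simp only [tsum_fintype]

namespace StocGame

variable {G : StocGame}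

/-- The mixed action that plays `a` with probability one. -/
def pureMixed {α : Type} [Fintype α] [DecidableEq α] (a : α) : Mixed α :=
  ⟨fun b => if b = a then 1 else 0, fun b => by dsimp only; split_ifs <;> norm_num, by simp⟩

theorem sum_prod_mixed {s : G.S} (τ : (j : G.I) → Mixed (G.A j s)) :
    ∑ a : G.Prof s, ∏ j, (τ j).1 (a j) = 1 := by
  have h := Finset.prod_univ_sum (fun j => (Finset.univ : Finset (G.A j s)))
    (fun j b => (τ j).1 b)
  rw [Fintype.piFinset_univ] at h
  rw [← h]
  exact Finset.prod_eq_one fun j _ => (τ j).2.2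

theorem probHistAux_nonneg (s0 : G.S) (σ : G.Profile) (l : List G.Step) (s : G.S) :
    0 ≤ probHistAux s0 σ l s := by
  induction l generalizing s with
  | nil => simp only [probHistAux]; split_ifs <;> norm_num
  | cons st l ih =>
    obtain ⟨s', a⟩ := st
    exact mul_nonneg (mul_nonneg (ih s') (Finset.prod_nonneg fun j _ => (σ j (l, s')).2.1 _))
      (G.q_nonneg _ _ _)

theorem sum_probHistAux_cons (s0 : G.S) (σ : G.Profile) (st : G.Step) (l : List G.Step) :
    ∑ s, probHistAux s0 σ (st :: l) s =
      probHistAux s0 σ l st.1 * ∏ j, (σ j (l, st.1)).1 (st.2 j) := by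
  obtain ⟨s', a⟩ := st
  simp only [probHistAux]
  rw [← Finset.mul_sum, G.q_sum, mul_one]

theorem sum_step_probHistAux (s0 : G.S) (σ : G.Profile) (l : List G.Step) :
    ∑ st : G.Step, ∑ s, probHistAux s0 σ (st :: l) s = ∑ s, probHistAux s0 σ l s := by
  simp only [sum_probHistAux_cons]
  rw [Fintype.sum_sigma]
  refine Finset.sum_congr rfl fun s _ => ?_
  dsimp only
  rw [← Finset.mul_sum, sum_prod_mixed (fun j => σ j (l, s)), mul_one]

theorem sum_ofFn_probHistAux (s0 : G.S) (σ : G.Profile) (n : ℕ) :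
    ∑ f : Fin n → G.Step, ∑ s, probHistAux s0 σ (List.ofFn f) s = 1 := by
  induction n with
  | zero => simp [probHistAux]
  | succ n ih =>
    rw [← ih, ← (Fin.consEquiv (fun _ : Fin (n + 1) => G.Step)).sum_comp,
      Fintype.sum_prod_type_right]
    refine Finset.sum_congr rfl fun f _ => ?_
    rw [← sum_step_probHistAux]
    refine Finset.sum_congr rfl fun st _ => ?_
    simp [Fin.consEquiv, List.ofFn_succ]

theorem summable_discounted {lam : ℝ} (hlam0 : 0 ≤ lam) (hlam1 : lam < 1) (s0 : G.S)
    (σ : G.Profile) :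
    Summable fun l : List G.Step => lam ^ l.length * ∑ s, probHistAux s0 σ l s := by
  rw [← List.equivSigmaTuple.symm.summable_iff, summable_sigma_of_nonneg]
  · refine ⟨fun n => (hasSum_fintype _).summable, ?_⟩
    convert summable_geometric_of_lt_one hlam0 hlam1 using 2 with n
    rw [tsum_fintype]
    simp only [Function.comp, List.equivSigmaTuple, Equiv.coe_fn_symm_mk, List.length_ofFn]
    rw [← Finset.mul_sum, sum_ofFn_probHistAux, mul_one]
  · exact fun x => mul_nonneg (pow_nonneg hlam0 _)
      (Finset.sum_nonneg fun s _ => probHistAux_nonneg _ _ _ _)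

theorem summable_discounted_mul {lam : ℝ} (hlam0 : 0 ≤ lam) (hlam1 : lam < 1) (s0 : G.S)
    (σ : G.Profile) (s : G.S) (w : List G.Step → ℝ) (C : ℝ) (hw : ∀ l, |w l| ≤ C) :
    Summable fun l : List G.Step => lam ^ l.length * (probHistAux s0 σ l s * w l) := by
  refine Summable.of_norm_bounded ((summable_discounted hlam0 hlam1 s0 σ).mul_right C)
    fun l => ?_
  have h1 := probHistAux_nonneg s0 σ l s
  have h2 : probHistAux s0 σ l s ≤ ∑ s, probHistAux s0 σ l s :=
    Finset.single_le_sum (f := fun s => probHistAux s0 σ l s)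
      (fun s _ => probHistAux_nonneg s0 σ l s) (Finset.mem_univ s)
  rw [Real.norm_eq_abs, abs_mul, abs_mul, abs_of_nonneg h1, abs_of_nonneg (pow_nonneg hlam0 _),
    mul_assoc]
  exact mul_le_mul_of_nonneg_left (mul_le_mul h2 (hw l) (abs_nonneg _) (h1.trans h2))
    (pow_nonneg hlam0 _)

theorem prod_mixed_le_one {s : G.S} (τ : (j : G.I) → Mixed (G.A j s)) (a : G.Prof s) :
    ∏ j, (τ j).1 (a j) ≤ 1 := by
  refine le_of_le_of_eq ?_ (sum_prod_mixed τ)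
  exact Finset.single_le_sum (f := fun a : G.Prof s => ∏ j, (τ j).1 (a j))
    (fun a _ => Finset.prod_nonneg fun j _ => (τ j).2.1 _) (Finset.mem_univ a)

theorem abs_prod_mixed_le_one {s : G.S} (τ : (j : G.I) → Mixed (G.A j s)) (a : G.Prof s) :
    |∏ j, (τ j).1 (a j)| ≤ 1 := by
  rw [abs_of_nonneg (Finset.prod_nonneg fun j _ => (τ j).2.1 _)]
  exact prod_mixed_le_one τ a

theorem tStep_eq {lam : ℝ} (hlam0 : 0 ≤ lam) (hlam1 : lam < 1) (s0 : G.S)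
    (σ : G.Profile) (st : G.Step) :
    tStep lam s0 σ st = (1 - lam) * ∑' l : List G.Step, lam ^ l.length *
      (probHistAux s0 σ l st.1 * ∏ j, (σ j (l, st.1)).1 (st.2 j)) := by
  let g : G.Hist → ℝ := fun h =>
    if h.1.head? = some st then lam ^ (h.1.length - 1) * probHist s0 σ h else 0
  have hcons (l : List G.Step) : ∑ st' : G.Step, ∑ s, g (st' :: l, s) =
      lam ^ l.length * (probHistAux s0 σ l st.1 * ∏ j, (σ j (l, st.1)).1 (st.2 j)) := by
    rw [Finset.sum_eq_single st, ← sum_probHistAux_cons, Finset.mul_sum]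
    · simp [g, probHist]
    · intro b _ hb
      simp [g, hb]
    · simp
  have hg0 (h : G.Hist) : 0 ≤ g h := by
    simp only [g]
    split_ifs
    · exact mul_nonneg (pow_nonneg hlam0 _) (probHistAux_nonneg _ _ _ _)
    · exact le_rfl
  have hS := summable_discounted_mul hlam0 hlam1 s0 σ st.1
    (fun l => ∏ j, (σ j (l, st.1)).1 (st.2 j)) 1 (fun l => abs_prod_mixed_le_one _ _)
  have hsum : Summable fun l : List G.Step => ∑ s, g (l, s) := by
    have hinj : Function.Injective fun l : List G.Step => st :: l := List.cons_injective
    rw [← hinj.summable_iff]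
    · refine hS.congr fun l => ?_
      rw [← hcons, Finset.sum_eq_single st]
      · rfl
      · intro b _ hb
        simp [g, hb]
      · simp
    · intro l hl
      refine Finset.sum_eq_zero fun s _ => ?_
      refine if_neg fun h => hl ?_
      cases l with
      | nil => simp at h
      | cons b l => exact ⟨l, by simp at h; simp [h]⟩
  have hg : Summable g := by
    rw [summable_prod_of_nonneg hg0]
    exact ⟨fun l => (hasSum_fintype _).summable, by simpa only [tsum_fintype] using hsum⟩
  unfold tStep
  congr 1
  change ∑' h, g h = _
  rw [hg.tsum_prod]
  simp only [tsum_fintype]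
  rw [tsum_list_eq_nil_add_cons hsum]
  simp only [hcons]
  simp [g]

/-- The one-stage payoff at the state `s` with stage reward `r` and continuation payoff `V`. -/
def bellman (lam : ℝ) (r : G.Step → ℝ) (V : G.S → ℝ) {s : G.S}
    (τ : (j : G.I) → Mixed (G.A j s)) : ℝ :=
  ∑ a : G.Prof s, (∏ j, (τ j).1 (a j)) * ((1 - lam) * r ⟨s, a⟩ + lam * ∑ s', G.q s a s' * V s')

theorem sum_tStep_mul_sub {lam : ℝ} (hlam0 : 0 ≤ lam) (hlam1 : lam < 1) (s0 : G.S)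
    (σ : G.Profile) (r : G.Step → ℝ) (V : G.S → ℝ) :
    ∑ st, tStep lam s0 σ st * r st - V s0 =
      ∑' l : List G.Step, lam ^ l.length * ∑ s, probHistAux s0 σ l s *
        (bellman lam r V (fun j => σ j (l, s)) - V s) := by
  have hV : Summable fun l : List G.Step => lam ^ l.length * ∑ s, probHistAux s0 σ l s * V s := by
    simp only [Finset.mul_sum]
    exact summable_sum fun s _ =>
      summable_discounted_mul hlam0 hlam1 s0 σ s (fun _ => V s) |V s| (fun _ => le_rfl)
  have hst (st : G.Step) (b : ℝ) : Summable fun l : List G.Step => lam ^ l.length *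
      (probHistAux s0 σ l st.1 * ∏ j, (σ j (l, st.1)).1 (st.2 j)) * b :=
    (summable_discounted_mul hlam0 hlam1 s0 σ st.1
      (fun l => ∏ j, (σ j (l, st.1)).1 (st.2 j)) 1 (fun l => abs_prod_mixed_le_one _ _)).mul_right b
  have hL : ∑ st, tStep lam s0 σ st * r st = ∑' l : List G.Step, ∑ st : G.Step, lam ^ l.length *
      (probHistAux s0 σ l st.1 * ∏ j, (σ j (l, st.1)).1 (st.2 j)) * ((1 - lam) * r st) := by
    rw [Summable.tsum_finsetSum fun st _ => hst st _]
    refine Finset.sum_congr rfl fun st _ => ?_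
    rw [tStep_eq hlam0 hlam1, tsum_mul_right]
    ring
  have hW := tsum_list_eq_nil_add_cons hV
  have hnil : lam ^ ([] : List G.Step).length * ∑ s, probHistAux s0 σ [] s * V s = V s0 := by
    simp [probHistAux]
  have hcons (l : List G.Step) (st : G.Step) :
      lam ^ (st :: l).length * ∑ s, probHistAux s0 σ (st :: l) s * V s =
      lam ^ l.length * (probHistAux s0 σ l st.1 * ∏ j, (σ j (l, st.1)).1 (st.2 j)) *
        (lam * ∑ s', G.q st.1 st.2 s' * V s') := by
    obtain ⟨s, a⟩ := st
    simp only [probHistAux, List.length_cons, Finset.mul_sum]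
    exact Finset.sum_congr rfl fun s' _ => by ring
  simp only [hcons, hnil] at hW
  have e : V s0 = (∑' l : List G.Step, lam ^ l.length * ∑ s, probHistAux s0 σ l s * V s) -
      ∑' l : List G.Step, ∑ st : G.Step, lam ^ l.length *
        (probHistAux s0 σ l st.1 * ∏ j, (σ j (l, st.1)).1 (st.2 j)) *
          (lam * ∑ s', G.q st.1 st.2 s' * V s') := by
    linarith
  rw [hL, e, ← sub_add, sub_add_eq_add_sub, ← Summable.tsum_add, ← Summable.tsum_sub]
  · refine tsum_congr fun l => ?_
    rw [← Finset.sum_add_distrib, Fintype.sum_sigma, Finset.mul_sum, Finset.mul_sum,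
      ← Finset.sum_sub_distrib]
    refine Finset.sum_congr rfl fun s _ => ?_
    rw [bellman, mul_sub, mul_sub, Finset.mul_sum, Finset.mul_sum]
    congr 1
    exact Finset.sum_congr rfl fun a _ => by ring
  · exact (summable_sum fun st _ => hst st _).add (summable_sum fun st _ => hst st _)
  · exact hV
  · exact summable_sum fun st _ => hst st _
  · exact summable_sum fun st _ => hst st _

/-- The mixed action profile in which player `i` uses `y` and the others play the
pure profile `a`. -/
def deviate {s : G.S} (i : G.I) (y : Mixed (G.A i s)) (a : G.Prof s) :
    (j : G.I) → Mixed (G.A j s) :=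
  Function.update (fun j => pureMixed (a j)) i y

theorem sum_mul_bellman_deviate (lam : ℝ) (r : G.Step → ℝ) (V : G.S → ℝ) {s : G.S} (i : G.I)
    (τ : (j : G.I) → Mixed (G.A j s)) :
    ∑ a : G.Prof s, (∏ j, (τ j).1 (a j)) * bellman lam r V (deviate i (τ i) a) =
      bellman lam r V τ := by
  simp only [bellman, Finset.mul_sum (s := (Finset.univ : Finset (G.Prof s)))]
  rw [Finset.sum_comm]
  refine Finset.sum_congr rfl fun b _ => ?_
  simp only [← mul_assoc]
  rw [← Finset.sum_mul]
  congr 1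
  have h := Finset.prod_univ_sum (fun j => (Finset.univ : Finset (G.A j s)))
    (fun j c => (τ j).1 c * if j = i then (τ j).1 (b j) else (if b j = c then 1 else 0))
  rw [Fintype.piFinset_univ] at h
  have hl : ∀ j, ∑ c, ((τ j).1 c * if j = i then (τ j).1 (b j) else (if b j = c then 1 else 0)) =
      (τ j).1 (b j) := by
    intro j
    by_cases hj : j = i
    · simp only [hj, if_true]
      rw [← Finset.sum_mul, (τ j).2.2, one_mul]
    · simp [hj]
  simp only [hl] at h
  rw [h]
  refine Finset.sum_congr rfl fun a _ => ?_
  rw [← Finset.prod_mul_distrib]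
  refine Finset.prod_congr rfl fun j _ => ?_
  congr 1
  by_cases hj : j = i
  · subst hj
    simp [deviate]
  · simp [deviate, hj, pureMixed]

theorem bellman_sub_le {lam : ℝ} (hlam0 : 0 ≤ lam) (r : G.Step → ℝ) (V W : G.S → ℝ) {s : G.S}
    (τ : (j : G.I) → Mixed (G.A j s)) :
    bellman lam r V τ ≤ bellman lam r W τ + lam * dist V W := by
  have h : bellman lam r W τ + lam * dist V W = ∑ a : G.Prof s, (∏ j, (τ j).1 (a j)) *
      ((1 - lam) * r ⟨s, a⟩ + lam * ∑ s', G.q s a s' * W s' + lam * dist V W) := by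
    simp only [mul_add _ _ (lam * dist V W), Finset.sum_add_distrib]
    rw [← Finset.sum_mul, sum_prod_mixed, one_mul, bellman]
  rw [h, bellman]
  refine Finset.sum_le_sum fun a _ => mul_le_mul_of_nonneg_left ?_
    (Finset.prod_nonneg fun j _ => (τ j).2.1 _)
  rw [add_assoc, ← mul_add]
  refine add_le_add le_rfl (mul_le_mul_of_nonneg_left ?_ hlam0)
  have h2 : ∑ s', G.q s a s' * W s' + dist V W = ∑ s', G.q s a s' * (W s' + dist V W) := by
    simp only [mul_add, Finset.sum_add_distrib]
    rw [← Finset.sum_mul, G.q_sum, one_mul]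
  rw [h2]
  refine Finset.sum_le_sum fun s' _ => mul_le_mul_of_nonneg_left ?_ (G.q_nonneg _ _ _)
  have h3 := dist_le_pi_dist V W s'
  rw [Real.dist_eq] at h3
  linarith [le_abs_self (V s' - W s')]

theorem exists_bellman_fixedPoint {lam : ℝ} (hlam0 : 0 ≤ lam) (hlam1 : lam < 1) (i : G.I)
    (xi : G.Stat i) (r : G.Step → ℝ) :
    ∃ (V : G.S → ℝ) (a : (s : G.S) → G.Prof s),
      (∀ s, bellman lam r V (deviate i (xi s) (a s)) = V s) ∧
      ∀ s b, V s ≤ bellman lam r V (deviate i (xi s) b) := by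
  let T : (G.S → ℝ) → G.S → ℝ := fun V s =>
    Finset.univ.inf' Finset.univ_nonempty fun a => bellman lam r V (deviate i (xi s) a)
  have hle (V W : G.S → ℝ) (s : G.S) : T V s ≤ T W s + lam * dist V W := by
    obtain ⟨b, -, hb⟩ := Finset.exists_mem_eq_inf' Finset.univ_nonempty
      fun a => bellman lam r W (deviate i (xi s) a)
    refine (Finset.inf'_le _ (Finset.mem_univ b)).trans ?_
    change _ ≤ Finset.univ.inf' _ _ + _
    rw [hb]
    exact bellman_sub_le hlam0 r V W _
  have hT : ContractingWith ⟨lam, hlam0⟩ T := by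
    refine ⟨by exact_mod_cast hlam1, LipschitzWith.of_dist_le_mul fun V W => ?_⟩
    refine (dist_pi_le_iff (mul_nonneg hlam0 dist_nonneg)).2 fun s => ?_
    rw [Real.dist_eq, abs_le]
    have h1 := hle V W s
    have h2 := hle W V s
    rw [dist_comm W V] at h2
    change -(lam * dist V W) ≤ _ ∧ _ ≤ lam * dist V W
    constructor <;> linarith
  have hfix : T (hT.fixedPoint T) = hT.fixedPoint T := hT.fixedPoint_isFixedPt
  choose a ha using fun s => Finset.exists_mem_eq_inf' Finset.univ_nonempty
    fun a => bellman lam r (hT.fixedPoint T) (deviate i (xi s) a)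
  refine ⟨hT.fixedPoint T, a, fun s => ?_, fun s b => ?_⟩
  · rw [← (ha s).2]
    exact congrFun hfix s
  · conv_lhs => rw [← hfix]
    exact Finset.inf'_le _ (Finset.mem_univ b)

/-- The pure stationary strategy profile that plays `a s` at every state `s`. -/
def pureStat (a : (s : G.S) → G.Prof s) : G.StatProf := fun j s => pureMixed (a s j)

/-- Against a stationary strategy, the other players have a pure stationary best reply
for any linear functional of the discounted occupation measure. -/
theorem exists_pureStat_sum_tStep_le {lam : ℝ} (hlam0 : 0 ≤ lam) (hlam1 : lam < 1) (s0 : G.S)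
    (i : G.I) (xi : G.Stat i) (r : G.Step → ℝ) :
    ∃ a : (s : G.S) → G.Prof s, ∀ σ : G.Profile,
      ∑ st, tStep lam s0 (Function.update (toB (pureStat a)) i (toB1 xi)) st * r st ≤
        ∑ st, tStep lam s0 (Function.update σ i (toB1 xi)) st * r st := by
  obtain ⟨V, a, ha, hV⟩ := exists_bellman_fixedPoint hlam0 hlam1 i xi r
  refine ⟨a, fun σ => ?_⟩
  have h1 := sum_tStep_mul_sub hlam0 hlam1 s0
    (Function.update (toB (pureStat a)) i (toB1 xi)) r V
  have h2 := sum_tStep_mul_sub hlam0 hlam1 s0 (Function.update σ i (toB1 xi)) r V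
  have h1' : ∀ (l : List G.Step) (s : G.S),
      bellman lam r V (fun j => Function.update (toB (pureStat a)) i (toB1 xi) j (l, s)) = V s := by
    intro l s
    rw [← ha s]
    congr 1
    funext j
    by_cases hj : j = i
    · subst hj
      simp [deviate, toB1]
    · simp [deviate, hj, toB, pureStat]
  have h2' : ∀ (l : List G.Step) (s : G.S),
      V s ≤ bellman lam r V (fun j => Function.update σ i (toB1 xi) j (l, s)) := by
    intro l s
    set τ : (j : G.I) → Mixed (G.A j s) := fun j => Function.update σ i (toB1 xi) j (l, s) with hτ
    have hi : τ i = xi s := by simp [hτ, toB1]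
    rw [← sum_mul_bellman_deviate lam r V i τ, hi]
    calc V s = ∑ b : G.Prof s, (∏ j, (τ j).1 (b j)) * V s := by
          rw [← Finset.sum_mul, sum_prod_mixed, one_mul]
      _ ≤ _ := Finset.sum_le_sum fun b _ => mul_le_mul_of_nonneg_left (hV s b)
          (Finset.prod_nonneg fun j _ => (τ j).2.1 _)
  simp only [h1', sub_self, mul_zero, Finset.sum_const_zero, tsum_zero] at h1
  have h3 : 0 ≤ ∑ st, tStep lam s0 (Function.update σ i (toB1 xi)) st * r st - V s0 := by
    rw [h2]
    exact tsum_nonneg fun l => mul_nonneg (pow_nonneg hlam0 _) (Finset.sum_nonneg fun s _ =>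
      mul_nonneg (probHistAux_nonneg _ _ _ _) (sub_nonneg.2 (h2' l s)))
  linarith

/-- A stage reward whose total discounted payoff is a supergradient of the modified payoff
at the strategy profile `σ`. -/
noncomputable def supergradient (lam : ℝ) (s0 : G.S) (σ : G.Profile) (i : G.I) (Di : Finset (Finset G.S))
    (c : Finset G.S → ℝ) (st : G.Step) : ℝ :=
  ∑ D ∈ Di, if st.1 ∈ D then
    (if UD lam s0 σ i D ≤ tSet lam s0 σ D * c D then G.u i st.1 st.2 else c D) else 0

theorem sum_tStep_mul_supergradient (lam : ℝ) (s0 : G.S) (σ ρ : G.Profile) (i : G.I)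
    (Di : Finset (Finset G.S)) (c : Finset G.S → ℝ) :
    ∑ st, tStep lam s0 ρ st * supergradient lam s0 σ i Di c st =
      ∑ D ∈ Di, if UD lam s0 σ i D ≤ tSet lam s0 σ D * c D then UD lam s0 ρ i D
        else tSet lam s0 ρ D * c D := by
  simp only [supergradient, Finset.mul_sum]
  rw [Finset.sum_comm]
  refine Finset.sum_congr rfl fun D _ => ?_
  split_ifs
  · exact Finset.sum_congr rfl fun st _ => by split_ifs <;> simp
  · rw [tSet, Finset.sum_mul]
    exact Finset.sum_congr rfl fun st _ => by split_ifs <;> simp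

theorem exists_pureStat_modPayoff_le {lam : ℝ} (hlam0 : 0 ≤ lam) (hlam1 : lam < 1) (s0 : G.S)
    (i : G.I) (Di : Finset (Finset G.S)) (c : Finset G.S → ℝ) (xi : G.Stat i) (σ : G.Profile) :
    ∃ a : (s : G.S) → G.Prof s,
      modPayoff lam s0 (Function.update (toB (pureStat a)) i (toB1 xi)) i Di c ≤
        modPayoff lam s0 (Function.update σ i (toB1 xi)) i Di c := by
  obtain ⟨a, ha⟩ := exists_pureStat_sum_tStep_le hlam0 hlam1 s0 i xi
    (supergradient lam s0 (Function.update σ i (toB1 xi)) i Di c)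
  refine ⟨a, ?_⟩
  have h := ha σ
  rw [sum_tStep_mul_supergradient, sum_tStep_mul_supergradient] at h
  refine le_trans (Finset.sum_le_sum fun D _ => ?_) (h.trans (Finset.sum_le_sum fun D _ => ?_))
  · split_ifs
    · exact min_le_left _ _
    · exact min_le_right _ _
  · split_ifs with hc
    · exact (min_eq_left hc).ge
    · exact (min_eq_right (not_le.1 hc).le).ge

end StocGame

open StocGame in
/-- restricting the minimizing players to stationary strategies does not
change the max-min value in stationary strategies of the modified game. -/
theorem stmt_15 (G : StocGame) (lam : ℝ) (hlam0 : 0 ≤ lam) (hlam1 : lam < 1) (s0 : G.S)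
    (i : G.I) (Di : Finset (Finset G.S)) (hDi : IsPartitionF Di)
    (c : Finset G.S → ℝ) :
    maxminModStat G lam s0 i Di c =
      ⨆ xi : G.Stat i, ⨅ σ : G.Profile,
        modPayoff lam s0 (Function.update σ i (toB1 xi)) i Di c := by
  unfold maxminModStat
  refine iSup_congr fun xi => ?_
  have key := exists_pureStat_modPayoff_le hlam0 hlam1 s0 i Di c xi
  obtain ⟨m, hm⟩ : BddBelow (Set.range fun a : (s : G.S) → G.Prof s =>
      modPayoff lam s0 (Function.update (toB (pureStat a)) i (toB1 xi)) i Di c) :=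
    (Set.finite_range _).bddBelow
  have hbdd (σ : G.Profile) :
      m ≤ modPayoff lam s0 (Function.update σ i (toB1 xi)) i Di c := by
    obtain ⟨a, ha⟩ := key σ
    exact (hm ⟨a, rfl⟩).trans ha
  have : Nonempty G.StatProf := ⟨pureStat fun _ => Classical.arbitrary _⟩
  have : Nonempty G.Profile := ⟨toB (Classical.arbitrary G.StatProf)⟩
  refine le_antisymm (le_ciInf fun σ => ?_) (le_ciInf fun x => ?_)
  · obtain ⟨a, ha⟩ := key σ
    refine (ciInf_le ⟨m, ?_⟩ (pureStat a)).trans ha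
    rintro _ ⟨x, rfl⟩
    exact hbdd (toB x)
  · refine ciInf_le ⟨m, ?_⟩ (toB x)
    rintro _ ⟨σ, rfl⟩
    exact hbdd σ
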